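/- Let X, Y, A, B be nonempty finite sets and N = |X×A| + |Y×B|, with real symmetric N×N matrices indexed by the disjoint union (X×A) ⊔ (Y×B). Then the set cl(CS+^N) ∩ 𝓑 is compact, and consequently cl(π(CS+^N ∩ 𝓑)) ⊆ π(cl(CS+^N) ∩ 𝓑). -/

import Mathlib

open Matrix

/-- The completely positive semidefinite cone, for matrices indexed by a finite type. -/
def IsCSPlus {ι : Type} [Fintype ι] (A : Matrix ι ι ℝ) : Prop :=
  ∃ d : ℕ, 1 ≤ d ∧ ∃ Z : ι → Matrix (Fin d) (Fin d) ℝ,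
    (∀ i, (Z i).PosSemidef) ∧ ∀ i j, A i j = (Z i * Z j).trace

/-- The affine space `𝓑` of symmetric matrices indexed by `(X×A) ⊔ (Y×B)` whose block sums
are all equal to one. -/
def InBset {X Y A B : Type} [Fintype X] [Fintype Y] [Fintype A] [Fintype B]
    (R : Matrix ((X × A) ⊕ (Y × B)) ((X × A) ⊕ (Y × B)) ℝ) : Prop :=
  R.IsSymm ∧
  (∀ x x' : X, (∑ a : A, ∑ a' : A, R (Sum.inl (x, a)) (Sum.inl (x', a'))) = 1) ∧
  (∀ y y' : Y, (∑ b : B, ∑ b' : B, R (Sum.inr (y, b)) (Sum.inr (y', b'))) = 1) ∧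
  (∀ (x : X) (y : Y), (∑ a : A, ∑ b : B, R (Sum.inl (x, a)) (Sum.inr (y, b))) = 1)

/-- The projection `π` sending `R` to the array `(R_{xa,yb})`. -/
def piMap {X Y A B : Type} [Fintype X] [Fintype Y] [Fintype A] [Fintype B]
    (R : Matrix ((X × A) ⊕ (Y × B)) ((X × A) ⊕ (Y × B)) ℝ) : (X × A) → (Y × B) → ℝ :=
  fun p q => R (Sum.inl p) (Sum.inr q)

open scoped MatrixOrder in
/-- The trace of a product of two positive semidefinite real matrices is nonnegative. -/
theorem Matrix.PosSemidef.trace_mul_nonneg_real {n : Type*} [Fintype n] {P Q : Matrix n n ℝ}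
    (hP : P.PosSemidef) (hQ : Q.PosSemidef) : 0 ≤ (P * Q).trace := by
  classical
  obtain ⟨C, rfl⟩ := CStarAlgebra.nonneg_iff_eq_star_mul_self.mp hP.nonneg
  rw [Matrix.star_eq_conjTranspose, Matrix.mul_assoc, Matrix.trace_mul_comm]
  exact (hQ.mul_mul_conjTranspose_same C).trace_nonneg

theorem nonneg_of_mem_closure_isCSPlus {ι : Type} [Fintype ι] {R : Matrix ι ι ℝ}
    (hR : R ∈ closure {R : Matrix ι ι ℝ | IsCSPlus R}) (i j : ι) : 0 ≤ R i j := by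
  have hclosed : IsClosed {R : Matrix ι ι ℝ | 0 ≤ R i j} :=
    isClosed_le continuous_const (continuous_id.matrix_elem i j)
  refine closure_minimal ?_ hclosed hR
  rintro S ⟨d, -, Z, hZ, hS⟩
  rw [Set.mem_ofPred_eq, hS]
  exact (hZ i).trace_mul_nonneg_real (hZ j)

theorem le_one_of_sum_sum_eq_one {α β : Type*} [Fintype α] [Fintype β] {f : α → β → ℝ}
    (hf : ∀ a b, 0 ≤ f a b) (hsum : ∑ a, ∑ b, f a b = 1) (a : α) (b : β) : f a b ≤ 1 :=
  calc f a b ≤ ∑ b, f a b :=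
        Finset.single_le_sum (fun b _ => hf a b) (Finset.mem_univ b)
    _ ≤ ∑ a, ∑ b, f a b :=
        Finset.single_le_sum (f := fun a => ∑ b, f a b)
          (fun a _ => Finset.sum_nonneg fun b _ => hf a b) (Finset.mem_univ a)
    _ = 1 := hsum

theorem InBset.le_one {X Y A B : Type} [Fintype X] [Fintype Y] [Fintype A] [Fintype B]
    {R : Matrix ((X × A) ⊕ (Y × B)) ((X × A) ⊕ (Y × B)) ℝ} (hR : InBset R)
    (hnonneg : ∀ i j, 0 ≤ R i j) (i j : (X × A) ⊕ (Y × B)) : R i j ≤ 1 := by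
  obtain ⟨hsymm, hX, hY, hXY⟩ := hR
  rcases i with ⟨x, a⟩ | ⟨y, b⟩ <;> rcases j with ⟨x', a'⟩ | ⟨y', b'⟩
  · exact le_one_of_sum_sum_eq_one (fun _ _ => hnonneg _ _) (hX x x') a a'
  · exact le_one_of_sum_sum_eq_one (fun _ _ => hnonneg _ _) (hXY x y') a b'
  · rw [← hsymm.apply]
    exact le_one_of_sum_sum_eq_one (fun _ _ => hnonneg _ _) (hXY x' y) a' b
  · exact le_one_of_sum_sum_eq_one (fun _ _ => hnonneg _ _) (hY y y') b b'

theorem isClosed_setOf_inBset {X Y A B : Type} [Fintype X] [Fintype Y] [Fintype A] [Fintype B] :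
    IsClosed {R : Matrix ((X × A) ⊕ (Y × B)) ((X × A) ⊕ (Y × B)) ℝ | InBset R} := by
  have hentry (i j : (X × A) ⊕ (Y × B)) :
      Continuous fun R : Matrix ((X × A) ⊕ (Y × B)) ((X × A) ⊕ (Y × B)) ℝ => R i j :=
    continuous_id.matrix_elem i j
  simp only [InBset, Set.ofPred_and, Set.ofPred_forall]
  refine (isClosed_eq continuous_id.matrix_transpose continuous_id).inter
    (IsClosed.inter ?_ (IsClosed.inter ?_ ?_)) <;>
  exact isClosed_iInter fun _ => isClosed_iInter fun _ => isClosed_eq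
    (continuous_finsetSum _ fun _ _ => continuous_finsetSum _ fun _ _ => hentry _ _)
    continuous_const

theorem isCompact_closure_isCSPlus_inter_inBset {X Y A B : Type}
    [Fintype X] [Fintype Y] [Fintype A] [Fintype B] :
    IsCompact (closure {R : Matrix ((X × A) ⊕ (Y × B)) ((X × A) ⊕ (Y × B)) ℝ | IsCSPlus R} ∩
      {R | InBset R}) := by
  have hbox : IsCompact (Set.univ.pi fun _ => Set.univ.pi fun _ => Set.Icc 0 1 :
      Set (Matrix ((X × A) ⊕ (Y × B)) ((X × A) ⊕ (Y × B)) ℝ)) :=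
    isCompact_univ_pi fun _ => isCompact_univ_pi fun _ => isCompact_Icc
  refine hbox.of_isClosed_subset (isClosed_closure.inter isClosed_setOf_inBset) ?_
  rintro R ⟨hcl, hB⟩ i - j -
  have hnonneg := nonneg_of_mem_closure_isCSPlus hcl
  exact ⟨hnonneg i j, InBset.le_one hB hnonneg i j⟩

theorem continuous_piMap {X Y A B : Type} [Fintype X] [Fintype Y] [Fintype A] [Fintype B] :
    Continuous (piMap (X := X) (Y := Y) (A := A) (B := B)) :=
  continuous_pi fun _ => continuous_pi fun _ => continuous_id.matrix_elem _ _

/-- `cl(CS+^N) ∩ 𝓑` is compact; consequently `cl(π(CS+^N ∩ 𝓑)) ⊆ π(cl(CS+^N) ∩ 𝓑)`. -/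
theorem stmt16 {X Y A B : Type} [Fintype X] [Fintype Y] [Fintype A] [Fintype B]
    [Nonempty X] [Nonempty Y] [Nonempty A] [Nonempty B] :
    IsCompact (closure {R : Matrix ((X × A) ⊕ (Y × B)) ((X × A) ⊕ (Y × B)) ℝ | IsCSPlus R} ∩
      {R | InBset R}) ∧
    closure (piMap '' ({R : Matrix ((X × A) ⊕ (Y × B)) ((X × A) ⊕ (Y × B)) ℝ | IsCSPlus R} ∩
        {R | InBset R})) ⊆
      piMap '' (closure {R : Matrix ((X × A) ⊕ (Y × B)) ((X × A) ⊕ (Y × B)) ℝ | IsCSPlus R} ∩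
        {R | InBset R}) := by
  have hcompact := isCompact_closure_isCSPlus_inter_inBset (X := X) (Y := Y) (A := A) (B := B)
  exact ⟨hcompact, closure_minimal
    (Set.image_mono (Set.inter_subset_inter_left _ subset_closure))
    (hcompact.image continuous_piMap).isClosed⟩
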